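/- arXiv:2405.18160 — 2 statements merged into one kernel-verified Lean document; each statement's English description precedes it below -/
import Mathlib

section
/- For u = (z₀, ξ₀) and v = (z_K, ξ_{K+1}) in ℝ^ℓ × ℝ^{d−ℓ}, define 𝒬_s(u, v) = ∫_{(ℝ^{d−ℓ})^{K}} min( exp(−βV(z₀, ξ₀)) Q(z₀, z_K) ∏_{k=0}^{K} P_{z̄_k(z₀, z_K)}(ξ_k, ξ_{k+1}), exp(−βV(z_K, ξ_{K+1})) Q(z_K, z₀) ∏_{k=0}^{K} P_{z̄_k(z_K, z₀)}(ξ_{K+1−k}, ξ_{K−k}) ) dξ_1 ⋯ dξ_K, where ξ₀ and ξ_{K+1} are the fixed endpoint coordinates and ξ_1, …, ξ_K are the integration variables. Then 𝒬_s is symmetric: 𝒬_s(u, v) = 𝒬_s(v, u) for all u, v ∈ ℝ^ℓ × ℝ^{d−ℓ}. -/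
open MeasureTheory

/-- The path `(ξ_0, ξ_1, …, ξ_{K-1}, ξ_K)` with fixed endpoints `ξ_0 = a`,
`ξ_K = b` and interior points `ξ_k = η_{k-1}` for `1 ≤ k ≤ K − 1`. -/
def pathFun {X : Type*} (K : ℕ) (a b : X) (η : Fin (K - 1) → X) : ℕ → X :=
  fun k => if h : 1 ≤ k ∧ k < K then η ⟨k - 1, by omega⟩ else if k = 0 then a else b

/-- Swapping the endpoints and reversing the interior points reverses the path. -/
theorem pathFun_rev {X : Type*} (K : ℕ) (a b : X) (η : Fin K → X) {j : ℕ} (hj : j ≤ K + 1) :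
    pathFun (K + 1) b a (fun i : Fin K => η i.rev) j = pathFun (K + 1) a b η (K + 1 - j) := by
  unfold pathFun
  by_cases h : 1 ≤ j ∧ j < K + 1
  · have h' : 1 ≤ K + 1 - j ∧ K + 1 - j < K + 1 := by omega
    rw [dif_pos h, dif_pos h']
    refine congrArg η (Fin.ext ?_)
    simp only [Fin.val_rev]
    omega
  · rw [dif_neg h, dif_neg (by omega)]
    rcases Nat.eq_zero_or_pos j with rfl | hj0
    · simp
    · have : j = K + 1 := by omega
      simp [this]

/-- Reversing the order of the coordinates does not change an integral over a finite power. -/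
theorem integral_comp_rev {X E : Type*} [MeasureSpace X] [SigmaFinite (volume : Measure X)]
    [NormedAddCommGroup E] [NormedSpace ℝ E] (K : ℕ) (f : (Fin K → X) → E) :
    ∫ η : Fin K → X, f (fun i => η i.rev) = ∫ η, f η := by
  have h := (volume_measurePreserving_piCongrLeft (fun _ : Fin K => X) Fin.revPerm).integral_comp' f
  rw [← h]
  congr 1
  funext η
  congr 1
  funext i
  simpa [MeasurableEquiv.coe_piCongrLeft] using
    (Equiv.piCongrLeft_apply_apply (fun _ : Fin K => X) Fin.revPerm η i.rev).symm

/-- Symmetry of the accepted-move joint density `𝒬_s` of the symmetric path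
algorithm (whose path `ξ_0, …, ξ_{K+1}` starts and ends with an equilibration
step): `𝒬_s(u, v) = 𝒬_s(v, u)`. -/
theorem stmt7 (ℓ d : ℕ) (hℓ : 0 < ℓ) (hld : ℓ < d)
    (β : ℝ) (hβ : 0 < β)
    (V : (Fin ℓ → ℝ) → (Fin (d - ℓ) → ℝ) → ℝ)
    (hV : Measurable (Function.uncurry V))
    (Q : (Fin ℓ → ℝ) → (Fin ℓ → ℝ) → ℝ)
    (hQmeas : Measurable (Function.uncurry Q))
    (hQnonneg : ∀ z z', 0 ≤ Q z z')
    (P : (Fin ℓ → ℝ) → (Fin (d - ℓ) → ℝ) → (Fin (d - ℓ) → ℝ) → ℝ)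
    (hPmeas : Measurable (fun q : (Fin ℓ → ℝ) × (Fin (d - ℓ) → ℝ) × (Fin (d - ℓ) → ℝ) =>
      P q.1 q.2.1 q.2.2))
    (hPnonneg : ∀ z x y, 0 ≤ P z x y)
    (K : ℕ) (hK : 1 ≤ K)
    (zbar : ℕ → (Fin ℓ → ℝ) → (Fin ℓ → ℝ) → (Fin ℓ → ℝ))
    (hzbarmeas : ∀ k, Measurable (Function.uncurry (zbar k)))
    (hzbar0 : ∀ a b, zbar 0 a b = a)
    (hzbarK : ∀ a b, zbar K a b = b)
    (Qs : ((Fin ℓ → ℝ) × (Fin (d - ℓ) → ℝ)) →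
      ((Fin ℓ → ℝ) × (Fin (d - ℓ) → ℝ)) → ℝ)
    (hQs : ∀ u v, Qs u v =
      ∫ η : Fin K → (Fin (d - ℓ) → ℝ),
        min
          (Real.exp (-β * V u.1 u.2) * Q u.1 v.1 *
            ∏ k ∈ Finset.range (K + 1),
              P (zbar k u.1 v.1) (pathFun (K + 1) u.2 v.2 η k)
                (pathFun (K + 1) u.2 v.2 η (k + 1)))
          (Real.exp (-β * V v.1 v.2) * Q v.1 u.1 *
            ∏ k ∈ Finset.range (K + 1),
              P (zbar k v.1 u.1) (pathFun (K + 1) u.2 v.2 η (K + 1 - k))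
                (pathFun (K + 1) u.2 v.2 η (K - k)))) :
    ∀ u v, Qs u v = Qs v u := by
  intro u v
  rw [hQs u v, hQs v u, ← integral_comp_rev]
  congr 1
  funext η
  rw [min_comm]
  congr 2
  all_goals
    refine Finset.prod_congr rfl fun k hk => ?_
    have hk' : k < K + 1 := Finset.mem_range.mp hk
    rw [pathFun_rev K _ _ η (by omega), pathFun_rev K _ _ η (by omega)]
    congr 2 <;> omega
end

section
/- Fix points ζ₀, …, ζ_K ∈ ℝ^ℓ with K ≥ 1. Assume 0 < ∫ exp(−βV(ζ₀, x)) dx < ∞ and 0 < ∫ exp(−βV(ζ_K, x)) dx < ∞, and that for each k ∈ {0, …, K} the kernel P_{ζ_k} leaves the conditional measure ν_⊥(· | ζ_k) invariant, i.e. ∫ exp(−βV(ζ_k, x)) P_{ζ_k}(x, y) dx = exp(−βV(ζ_k, y)) for almost every y ∈ ℝ^{d−ℓ}. Then for every bounded measurable φ : ℝ^{d−ℓ} → ℝ, ∫_{(ℝ^{d−ℓ})^{K+2}} φ(ξ_{K+1}) exp( −β ∑_{k=1}^{K} [ V(ζ_k, ξ_k) − V(ζ_{k−1}, ξ_k) ]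 ) · [ exp(−βV(ζ₀, ξ₀)) / ∫ exp(−βV(ζ₀, x)) dx ] · ∏_{k=0}^{K} P_{ζ_k}(ξ_k, ξ_{k+1}) dξ₀ ⋯ dξ_{K+1} = exp( −β (F(ζ_K) − F(ζ₀)) ) ∫_{ℝ^{d−ℓ}} φ(y) ν_⊥(dy | ζ_K). That is, the work 𝒲² = ∑_{k=1}^{K} [ V(ζ_k, ξ_k) − V(ζ_{k−1}, ξ_k) ] of the symmetric path algorithm, computed along the path where ξ₀ ∼ ν_⊥(· | ζ₀) and ξ_{k+1} ∼ P_{ζ_k}(ξ_k, ·) for k = 0, …, K, satisfies the Jarzynski equality E[ φ(ξ_{K+1}) exp(−β𝒲²) ] = exp(−β(F(ζ_K) − F(ζ₀))) ∫ φ dν_⊥(· | ζ_K). -/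
open MeasureTheory

/-- Extension of a tuple `η : Fin n → X` to a function on `ℕ` (the value beyond
`n` is irrelevant). -/
def extendPath {X : Type*} [Inhabited X] {n : ℕ} (η : Fin n → X) : ℕ → X :=
  fun k => if h : k < n then η ⟨k, h⟩ else default

open scoped ENNReal

theorem measurable_extendPath {X : Type*} [Inhabited X] [MeasurableSpace X] {n : ℕ} (k : ℕ) :
    Measurable (fun ξ : Fin n → X => extendPath ξ k) := by
  unfold extendPath
  split_ifs with h
  · exact measurable_pi_apply _
  · exact measurable_const

theorem extendPath_insertNth_last {X : Type*} [Inhabited X] {n : ℕ} (x : X) (η : Fin n → X) :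
    extendPath (Fin.insertNth (α := fun _ => X) (Fin.last n) x η) n = x := by
  simp only [extendPath, Nat.lt_succ_self, dif_pos]
  exact Fin.insertNth_apply_same (α := fun _ => X) (Fin.last n) x η

theorem extendPath_insertNth_of_lt {X : Type*} [Inhabited X] {n k : ℕ} (x : X) (η : Fin n → X)
    (hk : k < n) :
    extendPath (Fin.insertNth (α := fun _ => X) (Fin.last n) x η) k = extendPath η k := by
  simp only [extendPath, hk, Nat.lt_succ_of_lt hk, dif_pos]
  have := Fin.insertNth_apply_succAbove (α := fun _ => X) (Fin.last n) x η ⟨k, hk⟩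
  rwa [Fin.succAbove_last] at this

/-- The unnormalised path density: start from `g 0`, move with the kernels `p k`, and reweight
by `g (k + 1) / g k` after each move. -/
noncomputable def pathDensity {X : Type*} (g : ℕ → X → ℝ≥0∞) (p : ℕ → X → X → ℝ≥0∞) (n : ℕ)
    (s : ℕ → X) : ℝ≥0∞ :=
  g 0 (s 0) * ∏ k ∈ Finset.range n, p k (s k) (s (k + 1)) * (g (k + 1) (s (k + 1)) / g k (s (k + 1)))

theorem pathDensity_congr {X : Type*} (g : ℕ → X → ℝ≥0∞) (p : ℕ → X → X → ℝ≥0∞) {n : ℕ}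
    {s t : ℕ → X} (h : ∀ k ≤ n, s k = t k) : pathDensity g p n s = pathDensity g p n t := by
  unfold pathDensity
  rw [h 0 n.zero_le]
  congr 1
  refine Finset.prod_congr rfl fun k hk => ?_
  rw [Finset.mem_range] at hk
  rw [h k hk.le, h (k + 1) hk]

section

variable {X : Type*} [MeasureSpace X] {g : ℕ → X → ℝ≥0∞}
  {p : ℕ → X → X → ℝ≥0∞}

theorem measurable_pathDensity [Inhabited X] (hg : ∀ k, Measurable (g k))
    (hp : ∀ k, Measurable (Function.uncurry (p k))) (m n : ℕ) :
    Measurable (fun ξ : Fin m → X => pathDensity g p n (extendPath ξ)) := by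
  have hs := fun k => measurable_extendPath (X := X) (n := m) k
  unfold pathDensity
  refine ((hg 0).comp (hs 0)).mul (Finset.measurable_prod _ fun k _ => ?_)
  exact ((hp k).comp ((hs k).prodMk (hs (k + 1)))).mul
    (((hg (k + 1)).comp (hs (k + 1))).div ((hg k).comp (hs (k + 1))))

/-- Integrating out all but the endpoint of a reweighted path leaves the last weight. -/
theorem lintegral_pathDensity [Inhabited X] [SigmaFinite (volume : Measure X)]
    (hg : ∀ k, Measurable (g k))
    (hp : ∀ k, Measurable (Function.uncurry (p k))) (hg0 : ∀ k x, g k x ≠ 0)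
    (hgt : ∀ k x, g k x ≠ ∞) (n : ℕ)
    (hinv : ∀ k < n, ∀ᵐ y : X, ∫⁻ x, g k x * p k x y = g k y)
    {h : X → ℝ≥0∞} (hh : Measurable h) :
    ∫⁻ ξ : Fin (n + 1) → X, pathDensity g p n (extendPath ξ) * h (extendPath ξ n) =
      ∫⁻ x, g n x * h x := by
  induction n generalizing h with
  | zero =>
    have := (volume_preserving_funUnique (Fin 1) X).lintegral_comp ((hg 0).mul hh)
    refine Eq.trans (lintegral_congr fun ξ => ?_) this
    simp [pathDensity, extendPath, MeasurableEquiv.funUnique]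
  | succ n ih =>
    have hk : Measurable fun q : X × X => p n q.1 q.2 := hp n
    have hk' : Measurable fun q : X × X => p n q.2 q.1 := (hp n).comp measurable_swap
    set h' : X → ℝ≥0∞ := fun y => g (n + 1) y / g n y * h y with hh'
    have hh'm : Measurable h' := ((hg _).div (hg _)).mul hh
    set H : X → ℝ≥0∞ := fun x => ∫⁻ y, p n x y * h' y with hH
    have hHm : Measurable H :=
      Measurable.lintegral_prod_right (hk.mul (hh'm.comp measurable_snd))
    have mp := (volume_preserving_piFinSuccAbove (fun _ : Fin (n + 1 + 1) => X)
      (Fin.last (n + 1))).symm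
    have hm := (measurable_pathDensity hg hp (n + 1 + 1) (n + 1)).mul
      (hh.comp (measurable_extendPath (X := X) (n := n + 1 + 1) (n + 1)))
    calc
      _ = ∫⁻ q : X × (Fin (n + 1) → X),
            pathDensity g p n (extendPath q.2) * (p n (extendPath q.2 n) q.1 * h' q.1) := by
        refine (mp.lintegral_comp hm).symm.trans (lintegral_congr fun q => ?_)
        change pathDensity g p (n + 1) (extendPath
          (Fin.insertNth (α := fun _ => X) (Fin.last (n + 1)) q.1 q.2)) * h (extendPath
          (Fin.insertNth (α := fun _ => X) (Fin.last (n + 1)) q.1 q.2) (n + 1)) = _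
        rw [pathDensity, Finset.prod_range_succ, ← mul_assoc, ← pathDensity,
          extendPath_insertNth_last, extendPath_insertNth_of_lt _ _ n.lt_succ_self,
          pathDensity_congr g p fun k hk =>
            extendPath_insertNth_of_lt q.1 q.2 (Nat.lt_succ_of_le hk)]
        simp only [hh', mul_assoc]
      _ = ∫⁻ η : Fin (n + 1) → X, pathDensity g p n (extendPath η) * H (extendPath η n) := by
        have hd := measurable_pathDensity hg hp (n + 1) n
        have he := measurable_extendPath (X := X) (n := n + 1) n
        rw [Measure.volume_eq_prod, lintegral_prod_symm]
        · refine lintegral_congr fun η => ?_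
          exact lintegral_const_mul (pathDensity g p n (extendPath η))
            ((hk.comp (measurable_prodMk_left (x := extendPath η n))).mul hh'm)
        · exact ((hd.comp measurable_snd).mul
            ((hk.comp ((he.comp measurable_snd).prodMk measurable_fst)).mul
              (hh'm.comp measurable_fst))).aemeasurable
      _ = ∫⁻ x, g n x * H x := ih (fun k hk => hinv k (hk.trans n.lt_succ_self)) hHm
      _ = ∫⁻ x, ∫⁻ y, g n x * (p n x y * h' y) := by
        refine lintegral_congr fun x => ?_
        exact (lintegral_const_mul _ ((hk.comp measurable_prodMk_left).mul hh'm)).symm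
      _ = ∫⁻ y, ∫⁻ x, g n x * (p n x y * h' y) :=
        lintegral_lintegral_swap (((hg n).comp measurable_fst).mul
          (hk.mul (hh'm.comp measurable_snd))).aemeasurable
      _ = ∫⁻ y, g (n + 1) y * h y := by
        refine lintegral_congr_ae ?_
        filter_upwards [hinv n n.lt_succ_self] with y hy
        simp_rw [← mul_assoc]
        refine (lintegral_mul_const _
          ((hg n).mul (hk'.comp measurable_prodMk_left))).trans ?_
        simp only [Pi.mul_apply, Function.comp_apply]
        rw [hy, hh',
          ← mul_assoc, ENNReal.mul_div_cancel (hg0 n y) (hgt n y)]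

/-- The endpoint law of the reweighted path has density equal to the last weight. -/
theorem integral_pathDensity [Inhabited X] [SigmaFinite (volume : Measure X)]
    (hg : ∀ k, Measurable (g k))
    (hp : ∀ k, Measurable (Function.uncurry (p k))) (hg0 : ∀ k x, g k x ≠ 0)
    (hgt : ∀ k x, g k x ≠ ∞) (hpt : ∀ k x y, p k x y ≠ ∞) (n : ℕ)
    (hinv : ∀ k < n, ∀ᵐ y : X, ∫⁻ x, g k x * p k x y = g k y)
    {φ : X → ℝ} (hφ : Measurable φ) :
    ∫ ξ : Fin (n + 1) → X, (pathDensity g p n (extendPath ξ)).toReal * φ (extendPath ξ n) =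
      ∫ x, (g n x).toReal * φ x := by
  have hd := measurable_pathDensity hg hp (n + 1) n
  have he := measurable_extendPath (X := X) (n := n + 1) n
  have hfin (s : ℕ → X) : pathDensity g p n s < ∞ :=
    ENNReal.mul_lt_top (hgt _ _).lt_top (ENNReal.prod_lt_top fun k _ =>
      ENNReal.mul_lt_top (hpt _ _ _).lt_top (ENNReal.div_lt_top (hgt _ _) (hg0 _ _)))
  have hmap : ((volume : Measure (Fin (n + 1) → X)).withDensity
      fun ξ => pathDensity g p n (extendPath ξ)).map (fun ξ => extendPath ξ n) =
      volume.withDensity (g n) := by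
    refine Measure.ext_of_lintegral _ fun h hh => ?_
    rw [lintegral_map hh he, lintegral_withDensity_eq_lintegral_mul _ (hg n) hh]
    exact (lintegral_withDensity_eq_lintegral_mul _ hd (hh.comp he)).trans
      (lintegral_pathDensity hg hp hg0 hgt n hinv hh)
  have h1 := integral_withDensity_eq_integral_toReal_smul (μ := volume) (hg n)
    (ae_of_all _ fun x => (hgt n x).lt_top) φ
  have h2 := integral_withDensity_eq_integral_toReal_smul (μ := volume) hd
    (ae_of_all _ fun ξ => hfin (extendPath ξ)) (fun ξ => φ (extendPath ξ n))
  simp only [smul_eq_mul] at h1 h2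
  rw [← h1, ← h2, ← hmap, integral_map he.aemeasurable hφ.aestronglyMeasurable]

end

theorem lintegral_ofReal_of_integral_pos {X : Type*} [MeasurableSpace X] {μ : Measure X}
    {f : X → ℝ} {c : ℝ} (hf : ∀ x, 0 ≤ f x) (hc : 0 < c) (h : ∫ x, f x ∂μ = c) :
    ∫⁻ x, ENNReal.ofReal (f x) ∂μ = ENNReal.ofReal c := by
  have hi : Integrable f μ := by
    by_contra hn
    exact hc.ne' (h ▸ integral_undef hn)
  rw [← h, ofReal_integral_eq_lintegral_ofReal hi (ae_of_all _ hf)]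

/-- Jarzynski equality for the work
`𝒲² = ∑_{k=1}^{K} [V(ζ_k, ξ_k) − V(ζ_{k−1}, ξ_k)]` of the symmetric path
algorithm, along the path where `ξ_0 ∼ ν_⊥(·|ζ_0)` and
`ξ_{k+1} ∼ P_{ζ_k}(ξ_k, ·)` for `k = 0, …, K`:
`E[φ(ξ_{K+1}) exp(−β𝒲²)] = exp(−β(F(ζ_K) − F(ζ_0))) ∫ φ dν_⊥(·|ζ_K)`,
provided each kernel `P_{ζ_k}`, `0 ≤ k ≤ K`, leaves `ν_⊥(·|ζ_k)` invariant. -/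
theorem stmt14 (ℓ d : ℕ) (hℓ : 0 < ℓ) (hld : ℓ < d)
    (β : ℝ) (hβ : 0 < β)
    (V : (Fin ℓ → ℝ) → (Fin (d - ℓ) → ℝ) → ℝ)
    (hV : Measurable (Function.uncurry V))
    (Zc : ℝ)
    (hZc : Zc = ∫ x : (Fin ℓ → ℝ) × (Fin (d - ℓ) → ℝ), Real.exp (-β * V x.1 x.2))
    (hZpos : 0 < Zc)
    (hZfin : Integrable (fun x : (Fin ℓ → ℝ) × (Fin (d - ℓ) → ℝ) =>
      Real.exp (-β * V x.1 x.2)))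
    (F : (Fin ℓ → ℝ) → ℝ)
    (hF : ∀ z, F z = -β⁻¹ * Real.log (Zc⁻¹ * ∫ x : Fin (d - ℓ) → ℝ,
      Real.exp (-β * V z x)))
    (P : (Fin ℓ → ℝ) → (Fin (d - ℓ) → ℝ) → (Fin (d - ℓ) → ℝ) → ℝ)
    (hPmeas : Measurable (fun q : (Fin ℓ → ℝ) × (Fin (d - ℓ) → ℝ) × (Fin (d - ℓ) → ℝ) =>
      P q.1 q.2.1 q.2.2))
    (hPnonneg : ∀ z x y, 0 ≤ P z x y)
    (hPnorm : ∀ z x, (∫ y, P z x y) = 1)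
    (K : ℕ) (hK : 1 ≤ K)
    (ζ : ℕ → (Fin ℓ → ℝ))
    (h0pos : 0 < ∫ x : Fin (d - ℓ) → ℝ, Real.exp (-β * V (ζ 0) x))
    (h0fin : Integrable (fun x : Fin (d - ℓ) → ℝ => Real.exp (-β * V (ζ 0) x)))
    (hKpos : 0 < ∫ x : Fin (d - ℓ) → ℝ, Real.exp (-β * V (ζ K) x))
    (hKfin : Integrable (fun x : Fin (d - ℓ) → ℝ => Real.exp (-β * V (ζ K) x)))
    (hinv : ∀ k, k ≤ K →
      ∀ᵐ y : Fin (d - ℓ) → ℝ,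
        (∫ x, Real.exp (-β * V (ζ k) x) * P (ζ k) x y) = Real.exp (-β * V (ζ k) y))
    (φ : (Fin (d - ℓ) → ℝ) → ℝ)
    (hφmeas : Measurable φ) (hφbdd : ∃ C, ∀ x, |φ x| ≤ C) :
    ∫ ξ : Fin (K + 2) → (Fin (d - ℓ) → ℝ),
        φ (extendPath ξ (K + 1)) *
          Real.exp (-β * ∑ k ∈ Finset.Icc 1 K,
            (V (ζ k) (extendPath ξ k) - V (ζ (k - 1)) (extendPath ξ k))) *
          (Real.exp (-β * V (ζ 0) (extendPath ξ 0)) /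
            ∫ x : Fin (d - ℓ) → ℝ, Real.exp (-β * V (ζ 0) x)) *
          ∏ k ∈ Finset.range (K + 1), P (ζ k) (extendPath ξ k) (extendPath ξ (k + 1)) =
      Real.exp (-β * (F (ζ K) - F (ζ 0))) *
        ∫ y : Fin (d - ℓ) → ℝ,
          φ y * (Zc⁻¹ * Real.exp (-β * V (ζ K) y) / Real.exp (-β * F (ζ K))) := by
  set I : (Fin ℓ → ℝ) → ℝ := fun z => ∫ x : Fin (d - ℓ) → ℝ, Real.exp (-β * V z x) with hI
  change 0 < I (ζ 0) at h0pos
  change 0 < I (ζ K) at hKpos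
  have hexpF (z : Fin ℓ → ℝ) (hz : 0 < I z) : Real.exp (-β * F z) = Zc⁻¹ * I z := by
    rw [hF z, ← mul_assoc, neg_mul_neg, mul_inv_cancel₀ hβ.ne', one_mul,
      Real.exp_log (mul_pos (inv_pos.mpr hZpos) hz)]
  set w : ℕ → (Fin (d - ℓ) → ℝ) → ℝ := fun k x => Real.exp (-β * V (ζ (min k K)) x) with hw
  have hwpos (k x) : 0 < w k x := Real.exp_pos _
  have hwm (k) : Measurable (w k) :=
    ((hV.comp measurable_prodMk_left).const_mul _).exp
  have hPm (k) : Measurable (Function.uncurry (P (ζ k))) :=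
    hPmeas.comp measurable_prodMk_left
  have key := integral_pathDensity (X := Fin (d - ℓ) → ℝ)
    (g := fun k x => ENNReal.ofReal (w k x)) (p := fun k x y => ENNReal.ofReal (P (ζ k) x y))
    (fun k => (hwm k).ennreal_ofReal) (fun k => (hPm k).ennreal_ofReal)
    (fun k x => (ENNReal.ofReal_pos.mpr (hwpos k x)).ne') (fun _ _ => ENNReal.ofReal_ne_top)
    (fun _ _ _ => ENNReal.ofReal_ne_top) (K + 1)
    (fun k hk => by
      have hk' : k ≤ K := Nat.le_of_lt_succ hk
      filter_upwards [hinv k hk'] with y hy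
      simp_rw [← ENNReal.ofReal_mul (hwpos _ _).le]
      refine lintegral_ofReal_of_integral_pos
        (fun x => mul_nonneg (hwpos _ _).le (hPnonneg _ _ _)) (hwpos _ _) ?_
      simpa only [hw, min_eq_left hk'] using hy)
    hφmeas
  have hdens (s : ℕ → Fin (d - ℓ) → ℝ) :
      (pathDensity (fun k x => ENNReal.ofReal (w k x))
        (fun k x y => ENNReal.ofReal (P (ζ k) x y)) (K + 1) s).toReal =
      Real.exp (-β * ∑ k ∈ Finset.Icc 1 K, (V (ζ k) (s k) - V (ζ (k - 1)) (s k))) *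
        Real.exp (-β * V (ζ 0) (s 0)) *
        ∏ k ∈ Finset.range (K + 1), P (ζ k) (s k) (s (k + 1)) := by
    have hratio : ∏ k ∈ Finset.range (K + 1), w (k + 1) (s (k + 1)) / w k (s (k + 1)) =
        Real.exp (-β * ∑ k ∈ Finset.Icc 1 K, (V (ζ k) (s k) - V (ζ (k - 1)) (s k))) := by
      rw [Finset.prod_range_succ, show w (K + 1) = w K by simp [hw], div_self (hwpos _ _).ne',
        mul_one, Finset.mul_sum, Real.exp_sum, ← Finset.Ico_add_one_right_eq_Icc,
        Finset.prod_Ico_eq_prod_range]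
      refine Finset.prod_congr (by simp) fun k hk => ?_
      rw [Finset.mem_range, Nat.add_sub_cancel] at hk
      simp only [hw, add_comm 1 k, min_eq_left hk.le, min_eq_left (Nat.succ_le_of_lt hk),
        ← Real.exp_sub, Nat.add_sub_cancel]
      congr 1
      ring
    rw [pathDensity, ENNReal.toReal_mul, ENNReal.toReal_prod]
    simp only [ENNReal.toReal_mul, ENNReal.toReal_div, ENNReal.toReal_ofReal (hwpos _ _).le,
      ENNReal.toReal_ofReal (hPnonneg _ _ _)]
    rw [Finset.prod_mul_distrib, hratio]
    simp only [hw, Nat.zero_min]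
    ring
  simp only [hdens, ENNReal.toReal_ofReal (hwpos _ _).le] at key
  simp only [hw, min_eq_right K.le_succ] at key
  calc
    _ = (I (ζ 0))⁻¹ * ∫ y, Real.exp (-β * V (ζ K) y) * φ y := by
      rw [← key, ← integral_const_mul]
      refine integral_congr_ae (ae_of_all _ fun ξ => ?_)
      simp only [hI]
      ring
    _ = _ := by
      rw [mul_sub, Real.exp_sub, hexpF _ h0pos, hexpF _ hKpos, ← integral_const_mul,
        ← integral_const_mul]
      refine integral_congr_ae (ae_of_all _ fun y => ?_)
      simp only
      field_simp
end
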